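/- Suppose G(Λ, T₁, T₂, W_j) is a DVNUG Bessel sequence in ℓ²(Λ, ℂ^S) with Bessel bound β. Then for every l ∈ {1, …, S} and every j ∈ T₂, the coordinate system {E_{m/M} R_{2Nλ} [W_j]_l : λ ∈ Λ, m ∈ T₁} is a discrete nonuniform Gabor Bessel sequence in ℓ²(Λ, ℂ) with Bessel bound β; that is, Σ_{λ∈Λ} Σ_{m∈T₁} |⟨x, E_{m/M} R_{2Nλ} [W_j]_l⟩|² ≤ β‖x‖² for all x ∈ ℓ²(Λ, ℂ). -/

import Mathlib

noncomputable section

open MeasureTheory Complex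

namespace DVNUG

/-- The nonuniform translation set `Λ = {0, r/N} + 2ℤ`. -/
def Lambda (N r : ℕ) : Set ℝ :=
  {x : ℝ | ∃ n : ℤ, x = 2 * n ∨ x = (r : ℝ) / N + 2 * n}

/-- The spectrum `Ω = [0, 1/2) ∪ [N/2, (N+1)/2)`. -/
def Omega (N : ℕ) : Set ℝ :=
  Set.Ico (0 : ℝ) (1 / 2) ∪ Set.Ico ((N : ℝ) / 2) (((N : ℝ) + 1) / 2)

/-- Inner product on `ℂ^n` (paper convention `⟨x, y⟩ = Σ xₖ conj(yₖ)`). -/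
def csInner {n : ℕ} (x y : Fin n → ℂ) : ℂ :=
  ∑ k, x k * (starRingEnd ℂ) (y k)

/-- Squared Euclidean norm on `ℂ^n`. -/
def csNormSq {n : ℕ} (x : Fin n → ℂ) : ℝ := ∑ k, ‖x k‖ ^ 2

/-- Euclidean norm on `ℂ^n`. -/
def csNorm {n : ℕ} (x : Fin n → ℂ) : ℝ := Real.sqrt (csNormSq x)

/-- Membership in `ℓ²(Λ, ℂ^S)`. -/
def MemL2 (Λ : Set ℝ) {S : ℕ} (Z : ℝ → Fin S → ℂ) : Prop :=
  Summable fun lam : Λ => csNormSq (Z (lam : ℝ))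

/-- Inner product of `ℓ²(Λ, ℂ^S)`: `⟨Z, W⟩ = Σ_{λ∈Λ} Σ_k [Z(λ)]ₖ conj([W(λ)]ₖ)`. -/
def l2inner (Λ : Set ℝ) {S : ℕ} (Z W : ℝ → Fin S → ℂ) : ℂ :=
  ∑' lam : Λ, csInner (Z (lam : ℝ)) (W (lam : ℝ))

/-- Squared norm of `ℓ²(Λ, ℂ^S)`. -/
def l2normSq (Λ : Set ℝ) {S : ℕ} (Z : ℝ → Fin S → ℂ) : ℝ :=
  ∑' lam : Λ, csNormSq (Z (lam : ℝ))

/-- Shift operator `(R_a Z)(x) = Z(x − a)`. -/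
def shiftOp {S : ℕ} (a : ℝ) (Z : ℝ → Fin S → ℂ) : ℝ → Fin S → ℂ :=
  fun x => Z (x - a)

/-- Modulation operator `(E_b Z)(x) = e^{2πibx} Z(x)`. -/
def modOp {S : ℕ} (b : ℝ) (Z : ℝ → Fin S → ℂ) : ℝ → Fin S → ℂ :=
  fun x k => Complex.exp (2 * Real.pi * Complex.I * b * x) * Z x k

/-- Fourier transform: `[F(Z)(ξ)]ₖ = Σ_{λ∈Λ} [Z(λ)]ₖ e^{2πiλξ}`. -/
def fourier (N r : ℕ) {S : ℕ} (Z : ℝ → Fin S → ℂ) : ℝ → Fin S → ℂ :=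
  fun ξ k => ∑' lam : Lambda N r,
    Z (lam : ℝ) k * Complex.exp (2 * Real.pi * Complex.I * (lam : ℝ) * ξ)

/-- Gabor coefficient `⟨Z, E_{m/M} R_{2Nλ} W⟩`. -/
def gaborCoeff (N r M : ℕ) {S : ℕ} (Z W : ℝ → Fin S → ℂ) (m : ℕ) (lam : ℝ) : ℂ :=
  l2inner (Lambda N r) Z (modOp ((m : ℝ) / M) (shiftOp (2 * N * lam) W))

/-- For a fixed `λ ∈ Λ`, the sum `Σ_{m∈T₁} Σ_{j∈T₂} |⟨Z, E_{m/M} R_{2Nλ} W_j⟩|²`. -/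
def gaborSumFn (N r M P : ℕ) {S : ℕ} (W : ℕ → ℝ → Fin S → ℂ) (Z : ℝ → Fin S → ℂ)
    (lam : Lambda N r) : ℝ :=
  ∑ m ∈ Finset.range M, ∑ j ∈ Finset.range (P + 1),
    ‖gaborCoeff N r M Z (W j) m (lam : ℝ)‖ ^ 2

/-- The DVNUG system `G(Λ, T₁, T₂, W_j)` is a Bessel sequence with bound `β`. -/
def IsBessel (N r M P : ℕ) {S : ℕ} (W : ℕ → ℝ → Fin S → ℂ) (β : ℝ) : Prop :=
  ∀ Z : ℝ → Fin S → ℂ, MemL2 (Lambda N r) Z →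
    Summable (gaborSumFn N r M P W Z) ∧
    (∑' lam : Lambda N r, gaborSumFn N r M P W Z lam) ≤ β * l2normSq (Lambda N r) Z

/-- The DVNUG system `G(Λ, T₁, T₂, W_j)` is a frame with bounds `α`, `β`. -/
def IsFrame (N r M P : ℕ) {S : ℕ} (W : ℕ → ℝ → Fin S → ℂ) (α β : ℝ) : Prop :=
  ∀ Z : ℝ → Fin S → ℂ, MemL2 (Lambda N r) Z →
    Summable (gaborSumFn N r M P W Z) ∧
    α * l2normSq (Lambda N r) Z ≤ (∑' lam : Lambda N r, gaborSumFn N r M P W Z lam) ∧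
    (∑' lam : Lambda N r, gaborSumFn N r M P W Z lam) ≤ β * l2normSq (Lambda N r) Z

end DVNUG

open DVNUG MeasureTheory Complex


namespace DVNUG

/-- The `l`-th coordinate sequence of `Z`, as an element of `ℓ²(Λ, ℂ)`. -/
def coordSeq {S : ℕ} (Z : ℝ → Fin S → ℂ) (l : Fin S) : ℝ → Fin 1 → ℂ :=
  fun lam _ => Z lam l

end DVNUG

namespace DVNUG

/-- The embedding of scalar sequences into `ℂ^S`-valued ones, placed in the `l`-th coordinate. -/
def embedCoord {S : ℕ} (l : Fin S) (x : ℝ → Fin 1 → ℂ) : ℝ → Fin S → ℂ :=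
  fun lam => Pi.single l (x lam 0)

theorem csNormSq_embedCoord {S : ℕ} (l : Fin S) (x : ℝ → Fin 1 → ℂ) (t : ℝ) :
    csNormSq (embedCoord l x t) = csNormSq (x t) := by
  simp only [csNormSq, embedCoord, Fin.sum_univ_one]
  rw [Finset.sum_eq_single l]
  · simp
  · intro k _ hk
    simp [Pi.single_eq_of_ne hk]
  · simp

theorem csInner_embedCoord {S : ℕ} (l : Fin S) (x : ℝ → Fin 1 → ℂ) (t : ℝ) (w : Fin S → ℂ) :
    csInner (embedCoord l x t) w = csInner (x t) (fun _ => w l) := by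
  simp only [csInner, embedCoord, Fin.sum_univ_one]
  rw [Finset.sum_eq_single l]
  · simp
  · intro k _ hk
    simp [Pi.single_eq_of_ne hk]
  · simp

theorem gaborCoeff_embedCoord (N r M : ℕ) {S : ℕ} (l : Fin S) (x : ℝ → Fin 1 → ℂ)
    (W : ℝ → Fin S → ℂ) (m : ℕ) (t : ℝ) :
    gaborCoeff N r M (embedCoord l x) W m t = gaborCoeff N r M x (coordSeq W l) m t :=
  tsum_congr fun _ => csInner_embedCoord l x _ _

theorem gaborSumFn_nonneg (N r M P : ℕ) {S : ℕ} (W : ℕ → ℝ → Fin S → ℂ)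
    (Z : ℝ → Fin S → ℂ) (lam : Lambda N r) : 0 ≤ gaborSumFn N r M P W Z lam := by
  unfold gaborSumFn
  positivity

/-- The Gabor sum of a single coordinate window is dominated by the full vector-valued sum. -/
theorem gaborSumFn_coordSeq_le (N r M P : ℕ) {S : ℕ} (W : ℕ → ℝ → Fin S → ℂ) (l : Fin S)
    {j : ℕ} (hj : j ≤ P) (x : ℝ → Fin 1 → ℂ) (lam : Lambda N r) :
    gaborSumFn N r M 0 (fun _ => coordSeq (W j) l) x lam ≤
      gaborSumFn N r M P W (embedCoord l x) lam := by
  unfold gaborSumFn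
  refine Finset.sum_le_sum fun m _ => ?_
  simp only [zero_add, Finset.sum_range_one, gaborCoeff_embedCoord]
  exact Finset.single_le_sum
    (f := fun i => ‖gaborCoeff N r M x (coordSeq (W i) l) m (lam : ℝ)‖ ^ 2)
    (fun i _ => sq_nonneg _) (Finset.mem_range.2 (Nat.lt_succ_of_le hj))

end DVNUG

theorem statement14 (N M S P r : ℕ) (hN : 0 < N) (hM : 0 < M) (hS : 0 < S)
    (hrodd : Odd r) (hrcop : Nat.Coprime r N) (hr1 : 1 ≤ r) (hr2 : r ≤ 2 * N - 1)
    (W : ℕ → ℝ → Fin S → ℂ) (hW : ∀ j ≤ P, MemL2 (Lambda N r) (W j))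
    (β : ℝ) (hβ : 0 < β)
    (hbessel : IsBessel N r M P W β) :
    ∀ l : Fin S, ∀ j ≤ P, IsBessel N r M 0 (fun _ => coordSeq (W j) l) β := by
  intro l j hj x hx
  obtain ⟨hsum, hle⟩ := hbessel (embedCoord l x) (by
    simpa only [MemL2, csNormSq_embedCoord] using hx)
  have hdom := gaborSumFn_coordSeq_le N r M P W l hj x
  have hsum' := Summable.of_nonneg_of_le (gaborSumFn_nonneg N r M 0 _ x) hdom hsum
  refine ⟨hsum', (hsum'.tsum_le_tsum hdom hsum).trans ?_⟩
  simpa only [l2normSq, csNormSq_embedCoord] using hle
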